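/- Propositionally quantified modal logic L∃ (without the global modality) is closed for product update: for every event model A = (Σ, E, PRE) with preconditions in L∃, every event α ∈ Σ, and every formula ψ ∈ L∃, there exists a formula χ ∈ L∃ such that χ ≡ ⟨α⟩ψ is valid, i.e. for every relational model M and point ω: M, ω ⊨ χ if and only if M, ω ⊨ Pre_α and M ⊗ A, (ω, α) ⊨ ψ. -/

import Mathlib

/-- A relational model over a set of worlds `W`. -/
structure Model (W : Type) where
  rel : W → W → Prop
  val : ℕ → Set W

/-- Change the valuation of the proposition letter `p` to `X`. -/
def Model.update {W : Type} (M : Model W) (p : ℕ) (X : Set W) : Model W :=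
  ⟨M.rel, fun q => if q = p then X else M.val q⟩

/-- Restriction (relativisation) of a model to a subset of its domain. -/
def Model.restrict {W : Type} (M : Model W) (A : Set W) : Model A :=
  ⟨fun a b => M.rel a.1 b.1, fun p => {a | a.1 ∈ M.val p}⟩

/-- The language `L∃U`: propositionally quantified modal logic with the global modality. -/
inductive Form : Type where
  | atom : ℕ → Form
  | neg : Form → Form
  | and : Form → Form → Form
  | box : Form → Form
  | ex : ℕ → Form → Form
  | uni : Form → Form

/-- Satisfaction for `L∃U`. -/
def Sat {W : Type} : Model W → W → Form → Prop
  | M, w, .atom p => w ∈ M.val p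
  | M, w, .neg φ => ¬ Sat M w φ
  | M, w, .and φ ψ => Sat M w φ ∧ Sat M w ψ
  | M, w, .box φ => ∀ v, M.rel w v → Sat M v φ
  | M, w, .ex p φ => ∃ X : Set W, Sat (M.update p X) w φ
  | M, w, .uni φ => ∀ v, Sat M v φ

/-- Material implication, `φ ⊃ ψ`. -/
def Form.imp (φ ψ : Form) : Form := .neg (.and φ (.neg ψ))

/-- The proposition letter `p` occurs in a formula. -/
def Form.Occurs (p : ℕ) : Form → Prop
  | .atom q => q = p
  | .neg φ => φ.Occurs p
  | .and φ ψ => φ.Occurs p ∨ ψ.Occurs p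
  | .box φ => φ.Occurs p
  | .ex q φ => q = p ∨ φ.Occurs p
  | .uni φ => φ.Occurs p

/-- The formula contains no global modality `U` (i.e. is in `L∃`). -/
def Form.UFree : Form → Prop
  | .atom _ => True
  | .neg φ => φ.UFree
  | .and φ ψ => φ.UFree ∧ ψ.UFree
  | .box φ => φ.UFree
  | .ex _ φ => φ.UFree
  | .uni _ => False

/-- Semantics of the dynamic relativisation (public announcement) modality `⟨!A⟩φ`. -/
def SatRel {W : Type} (M : Model W) (w : W) (A φ : Form) : Prop :=
  ∃ h : w ∈ {v | Sat M v A}, Sat (M.restrict {v | Sat M v A}) ⟨w, h⟩ φ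

/-- An event model with `n` events `α_0, …, α_{n-1}`, preconditions in `L∃U`. -/
structure EventModel (n : ℕ) where
  E : Fin n → Fin n → Prop
  pre : Fin n → Form

/-- The domain of the product update `M ⊗ A`. -/
def prodDomain {W : Type} (M : Model W) {n : ℕ} (A : EventModel n) : Set (W × Fin n) :=
  {x | Sat M x.1 (A.pre x.2)}

/-- The product update `M ⊗ A`. -/
def prodModel {W : Type} (M : Model W) {n : ℕ} (A : EventModel n) :
    Model (prodDomain M A) :=
  ⟨fun x y => M.rel x.1.1 y.1.1 ∧ A.E x.1.2 y.1.2, fun p => {x | x.1.1 ∈ M.val p}⟩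

/-- Semantics of the action modality `⟨α⟩φ` for `φ ∈ L∃U`. -/
def SatAct {W : Type} {n : ℕ} (M : Model W) (A : EventModel n) (α : Fin n) (w : W)
    (φ : Form) : Prop :=
  ∃ h : (w, α) ∈ prodDomain M A, Sat (prodModel M A) ⟨(w, α), h⟩ φ

/-- The set of sentences `S∃Uj`: `L∃U` plus action nominals `j_i`. -/
inductive FormJ (n : ℕ) : Type where
  | atom : ℕ → FormJ n
  | nom : Fin n → FormJ n
  | neg : FormJ n → FormJ n
  | and : FormJ n → FormJ n → FormJ n
  | box : FormJ n → FormJ n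
  | ex : ℕ → FormJ n → FormJ n
  | uni : FormJ n → FormJ n

/-- Satisfaction for `S∃Uj`, relative to a labelling of worlds by events
(in a product model `M ⊗ A` the label of `(ω, α)` is `α`). -/
def SatJ {n : ℕ} {V : Type} (lab : V → Fin n) : Model V → V → FormJ n → Prop
  | M, w, .atom p => w ∈ M.val p
  | _, w, .nom i => lab w = i
  | M, w, .neg φ => ¬ SatJ lab M w φ
  | M, w, .and φ ψ => SatJ lab M w φ ∧ SatJ lab M w ψ
  | M, w, .box φ => ∀ v, M.rel w v → SatJ lab M v φ
  | M, w, .ex p φ => ∃ X : Set V, SatJ lab (M.update p X) w φ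
  | M, w, .uni φ => ∀ v, SatJ lab M v φ

/-- Semantics of the action modality `⟨α⟩ψ` applied to a sentence `ψ ∈ S∃Uj`:
`M, w ⊨ ⟨α⟩ψ` iff `M, w ⊨ Pre_α` and `M ⊗ A, (w, α) ⊨ ψ`. -/
def SatActJ {W : Type} {n : ℕ} (M : Model W) (A : EventModel n) (α : Fin n) (w : W)
    (ψ : FormJ n) : Prop :=
  ∃ h : (w, α) ∈ prodDomain M A,
    SatJ (fun x : prodDomain M A => x.1.2) (prodModel M A) ⟨(w, α), h⟩ ψ

/-- The proposition letter `p` occurs in a sentence of `S∃Uj`. -/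
def FormJ.Occurs {n : ℕ} (p : ℕ) : FormJ n → Prop
  | .atom q => q = p
  | .nom _ => False
  | .neg φ => φ.Occurs p
  | .and φ ψ => φ.Occurs p ∨ ψ.Occurs p
  | .box φ => φ.Occurs p
  | .ex q φ => q = p ∨ φ.Occurs p
  | .uni φ => φ.Occurs p

/-- Substitution `φ(σ)` of the sentence `σ` for the proposition letter `p` in `φ`. -/
def FormJ.subst {n : ℕ} (p : ℕ) (σ : FormJ n) : FormJ n → FormJ n
  | .atom q => if q = p then σ else .atom q
  | .nom i => .nom i
  | .neg φ => .neg (FormJ.subst p σ φ)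
  | .and φ ψ => .and (FormJ.subst p σ φ) (FormJ.subst p σ ψ)
  | .box φ => .box (FormJ.subst p σ φ)
  | .ex q φ => if q = p then .ex q φ else .ex q (FormJ.subst p σ φ)
  | .uni φ => .uni (FormJ.subst p σ φ)

/-- Disjunction, defined from `¬` and `∧`. -/
def FormJ.or {n : ℕ} (φ ψ : FormJ n) : FormJ n := .neg (.and (.neg φ) (.neg ψ))

/-- Finite disjunction `⋁`. -/
def FormJ.bigOr {n : ℕ} : List (FormJ n) → FormJ n
  | [] => .and (.atom 0) (.neg (.atom 0))
  | [φ] => φ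
  | φ :: ψ :: rest => φ.or (FormJ.bigOr (ψ :: rest))

/-- Simultaneous update of the valuation of the (distinct) letters `ps i` to `X i`. -/
def Model.updateMany {W : Type} (M : Model W) {n : ℕ} (ps : Fin n → ℕ)
    (X : Fin n → Set W) : Model W :=
  ⟨M.rel, fun q => {w | (∃ i, ps i = q ∧ w ∈ X i) ∨ ((∀ i, ps i ≠ q) ∧ w ∈ M.val q)}⟩

/-- A concrete numerical encoding of `L∃U` formulas. -/
def Form.toNat : Form → ℕ
  | .atom p => Nat.pair 0 p
  | .neg φ => Nat.pair 1 φ.toNat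
  | .and φ ψ => Nat.pair 2 (Nat.pair φ.toNat ψ.toNat)
  | .box φ => Nat.pair 3 φ.toNat
  | .ex p φ => Nat.pair 4 (Nat.pair p φ.toNat)
  | .uni φ => Nat.pair 5 φ.toNat

/-- The language `L∃Uα`: `L∃U` with action modalities `⟨α⟩` for events `α` of an event model. -/
inductive FormA (n : ℕ) : Type where
  | atom : ℕ → FormA n
  | neg : FormA n → FormA n
  | and : FormA n → FormA n → FormA n
  | box : FormA n → FormA n
  | ex : ℕ → FormA n → FormA n
  | uni : FormA n → FormA n
  | act : Fin n → FormA n → FormA n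

/-- Satisfaction for `L∃Uα`, relative to a fixed event model `A`. -/
def SatA {n : ℕ} (A : EventModel n) : (W : Type) → Model W → W → FormA n → Prop
  | _, M, w, .atom p => w ∈ M.val p
  | W, M, w, .neg φ => ¬ SatA A W M w φ
  | W, M, w, .and φ ψ => SatA A W M w φ ∧ SatA A W M w ψ
  | W, M, w, .box φ => ∀ v, M.rel w v → SatA A W M v φ
  | W, M, w, .ex p φ => ∃ X : Set W, SatA A W (M.update p X) w φ
  | W, M, w, .uni φ => ∀ v, SatA A W M v φ
  | _, M, w, .act β φ => ∃ h : (w, β) ∈ prodDomain M A,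
      SatA A (prodDomain M A) (prodModel M A) ⟨(w, β), h⟩ φ

/-- The set of points reachable from `ω` in at most `k` steps along `R`. -/
def reachWithin {W : Type} (M : Model W) (ω : W) : ℕ → Set W
  | 0 => {ω}
  | k + 1 => reachWithin M ω k ∪ {v | ∃ u ∈ reachWithin M ω k, M.rel u v}

theorem mem_reachWithin_self {W : Type} (M : Model W) (ω : W) (k : ℕ) :
    ω ∈ reachWithin M ω k := by
  induction k with
  | zero => exact rfl
  | succ k ih => exact Or.inl ih

/-- `M^k_ω`: the submodel of `M` generated by going at most `k` steps along `R` from `ω`. -/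
def Model.genSub {W : Type} (M : Model W) (ω : W) (k : ℕ) : Model (reachWithin M ω k) :=
  M.restrict (reachWithin M ω k)

/-- `φ ∈ L∃U` has degree `k`. -/
def HasDegreeForm (φ : Form) (k : ℕ) : Prop :=
  ∀ (W : Type) (M : Model W) (ω : W),
    Sat M ω φ ↔ Sat (M.genSub ω k) ⟨ω, mem_reachWithin_self M ω k⟩ φ

/-- `φ ∈ L∃Uα` has degree `k`. -/
def HasDegreeA {n : ℕ} (A : EventModel n) (φ : FormA n) (k : ℕ) : Prop :=
  ∀ (W : Type) (M : Model W) (ω : W),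
    SatA A W M ω φ ↔
      SatA A (reachWithin M ω k) (M.genSub ω k) ⟨ω, mem_reachWithin_self M ω k⟩ φ

/-- `deg(φ)` for `φ ∈ L∃U` (the least degree; `sInf ∅ = 0` by convention). -/
noncomputable def degForm (φ : Form) : ℕ := sInf {k | HasDegreeForm φ k}

/-- `deg(φ)` for `φ ∈ L∃Uα`. -/
noncomputable def degA {n : ℕ} (A : EventModel n) (φ : FormA n) : ℕ :=
  sInf {k | HasDegreeA A φ k}

/-- `Z` is a bisimulation between `M` and `M'`. -/
def IsBisim {W W' : Type} (M : Model W) (M' : Model W') (Z : W → W' → Prop) : Prop :=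
  ∀ s t, Z s t →
    (∀ p, s ∈ M.val p ↔ t ∈ M'.val p) ∧
    (∀ s₁, M.rel s s₁ → ∃ t₁, M'.rel t t₁ ∧ Z s₁ t₁) ∧
    (∀ t₁, M'.rel t t₁ → ∃ s₁, M.rel s s₁ ∧ Z s₁ t₁)

/-- `φ ∈ L∃U` is bisimulation-invariant. -/
def BisimInvariant (φ : Form) : Prop :=
  ∀ (W W' : Type) (M : Model W) (M' : Model W') (Z : W → W' → Prop),
    IsBisim M M' Z → ∀ w w', Z w w' → (Sat M w φ ↔ Sat M' w' φ)

/-- The modal fixpoint language `L_μ` (with greatest-fixpoint binders `ν`). -/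
inductive Formμ : Type where
  | atom : ℕ → Formμ
  | neg : Formμ → Formμ
  | and : Formμ → Formμ → Formμ
  | box : Formμ → Formμ
  | nu : ℕ → Formμ → Formμ

mutual
/-- All occurrences of `p` are under an even number of negations. -/
def PosIn (p : ℕ) : Formμ → Prop
  | .atom _ => True
  | .neg φ => NegIn p φ
  | .and φ ψ => PosIn p φ ∧ PosIn p ψ
  | .box φ => PosIn p φ
  | .nu q φ => q = p ∨ PosIn p φ

/-- All occurrences of `p` are under an odd number of negations. -/
def NegIn (p : ℕ) : Formμ → Prop
  | .atom q => q ≠ p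
  | .neg φ => PosIn p φ
  | .and φ ψ => NegIn p φ ∧ NegIn p ψ
  | .box φ => NegIn p φ
  | .nu q φ => q = p ∨ NegIn p φ
end

/-- Well-formedness for `L_μ`: in each `νp.φ`, `φ` is positive in `p`. -/
def WFμ : Formμ → Prop
  | .atom _ => True
  | .neg φ => WFμ φ
  | .and φ ψ => WFμ φ ∧ WFμ ψ
  | .box φ => WFμ φ
  | .nu q φ => PosIn q φ ∧ WFμ φ

/-- Satisfaction for `L_μ`: `⟦νp.φ⟧ = ⋃ {X | ∀ ω ∈ X, M[p ↦ X], ω ⊨ φ}`. -/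
def Satμ {W : Type} : Model W → W → Formμ → Prop
  | M, w, .atom p => w ∈ M.val p
  | M, w, .neg φ => ¬ Satμ M w φ
  | M, w, .and φ ψ => Satμ M w φ ∧ Satμ M w ψ
  | M, w, .box φ => ∀ v, M.rel w v → Satμ M v φ
  | M, w, .nu q φ => w ∈ ⋃₀ {X : Set W | ∀ v ∈ X, Satμ (M.update q X) v φ}

/-- An event model with preconditions in `L_μ`. -/
structure EventModelμ (n : ℕ) where
  E : Fin n → Fin n → Prop
  pre : Fin n → Formμ

/-- The domain of the product update `M ⊗ A` for `L_μ` event models. -/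
def prodDomainμ {W : Type} (M : Model W) {n : ℕ} (A : EventModelμ n) : Set (W × Fin n) :=
  {x | Satμ M x.1 (A.pre x.2)}

/-- The product update `M ⊗ A` for `L_μ` event models. -/
def prodModelμ {W : Type} (M : Model W) {n : ℕ} (A : EventModelμ n) :
    Model (prodDomainμ M A) :=
  ⟨fun x y => M.rel x.1.1 y.1.1 ∧ A.E x.1.2 y.1.2, fun p => {x | x.1.1 ∈ M.val p}⟩

/-- Satisfaction depends only on the relation and on the letters occurring in the formula. -/
theorem sat_congr {W : Type} {R : W → W → Prop} (φ : Form) {V V' : ℕ → Set W}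
    (h : ∀ p, φ.Occurs p → V p = V' p) (w : W) : Sat ⟨R, V⟩ w φ ↔ Sat ⟨R, V'⟩ w φ := by
  induction φ generalizing V V' w with
  | atom p => simp only [Sat, h p rfl]
  | neg φ ih => exact not_congr (ih h w)
  | and φ ψ ih₁ ih₂ =>
    exact and_congr (ih₁ (fun p hp => h p (Or.inl hp)) w) (ih₂ (fun p hp => h p (Or.inr hp)) w)
  | box φ ih => exact forall_congr' fun v => imp_congr_right fun _ => ih h v
  | ex q φ ih =>
    refine exists_congr fun X => ih (fun p hp => ?_) w
    dsimp only
    rw [h p (Or.inr hp)]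
  | uni φ ih => exact forall_congr' fun v => ih h v

theorem Form.exists_occurs_bound (φ : Form) : ∃ N, ∀ p, φ.Occurs p → p < N := by
  induction φ with
  | atom q => exact ⟨q + 1, fun p (hp : q = p) => by omega⟩
  | neg φ ih => exact ih
  | and φ ψ ih₁ ih₂ =>
    obtain ⟨a, ha⟩ := ih₁
    obtain ⟨b, hb⟩ := ih₂
    exact ⟨max a b, fun p hp => lt_max_iff.2 (hp.imp (ha p) (hb p))⟩
  | box φ ih => exact ih
  | ex q φ ih =>
    obtain ⟨a, ha⟩ := ih
    refine ⟨max (q + 1) a, fun p hp => lt_max_iff.2 (hp.imp (fun h => ?_) (ha p))⟩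
    omega
  | uni φ ih => exact ih

/-- The conjunction of `base` with all formulas in a list. -/
def Form.conj (base : Form) : List Form → Form
  | [] => base
  | φ :: l => .and φ (Form.conj base l)

theorem sat_conj {W : Type} (M : Model W) (w : W) (base : Form) (l : List Form) :
    Sat M w (Form.conj base l) ↔ Sat M w base ∧ ∀ φ ∈ l, Sat M w φ := by
  induction l with
  | nil => simp [Form.conj]
  | cons φ l ih =>
    simp only [Form.conj, Sat, ih, List.forall_mem_cons]
    tauto

theorem Form.UFree.conj {base : Form} (hb : base.UFree) {l : List Form}
    (hl : ∀ φ ∈ l, φ.UFree) : (Form.conj base l).UFree := by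
  induction l with
  | nil => exact hb
  | cons φ l ih => exact ⟨hl φ (by simp), ih fun ψ hψ => hl ψ (by simp [hψ])⟩

/-- Existential quantification over the letters `k, …, k + m - 1`. -/
def Form.exMany (k : ℕ) : ℕ → Form → Form
  | 0, φ => φ
  | m + 1, φ => .ex (k + m) (Form.exMany k m φ)

theorem sat_exMany {W : Type} (R : W → W → Prop) (k m : ℕ) (V : ℕ → Set W) (w : W) (φ : Form) :
    Sat ⟨R, V⟩ w (Form.exMany k m φ) ↔
      ∃ V' : ℕ → Set W, (∀ q, q < k ∨ k + m ≤ q → V' q = V q) ∧ Sat ⟨R, V'⟩ w φ := by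
  induction m generalizing V with
  | zero =>
    refine ⟨fun h => ⟨V, fun _ _ => rfl, h⟩, fun ⟨V', hV, h⟩ => ?_⟩
    obtain rfl : V' = V := funext fun q => hV q (by omega)
    exact h
  | succ m ih =>
    constructor
    · rintro ⟨X, hX⟩
      obtain ⟨V', hV, h⟩ := (ih _).1 hX
      refine ⟨V', fun q hq => ?_, h⟩
      rw [hV q (by omega), if_neg (by omega)]
    · rintro ⟨V', hV, h⟩
      refine ⟨V' (k + m), (ih _).2 ⟨V', fun q hq => ?_, h⟩⟩
      dsimp only
      split_ifs with e
      · rw [e]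
      · exact hV q (by omega)

theorem Form.UFree.exMany {φ : Form} (h : φ.UFree) (k m : ℕ) : (Form.exMany k m φ).UFree := by
  induction m with
  | zero => exact h
  | succ m ih => exact ih

open Classical in
/-- The translation of `⟨α_i⟩φ` into the static language. The letter `p` is represented at
event `j` by the letter `ρ p j`, and the letters from `k` on are available for quantification. -/
noncomputable def EventModel.translate {n : ℕ} (A : EventModel n) :
    Form → (ℕ → Fin n → ℕ) → ℕ → Fin n → Form
  | .atom p, ρ, _, i => .and (A.pre i) (.atom (ρ p i))
  | .neg φ, ρ, k, i => .and (A.pre i) (.neg (A.translate φ ρ k i))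
  | .and φ ψ, ρ, k, i => .and (A.translate φ ρ k i) (A.translate ψ ρ k i)
  | .box φ, ρ, k, i => Form.conj (A.pre i) (((List.finRange n).filter fun j => A.E i j).map
      fun j => .box ((A.pre j).imp (A.translate φ ρ k j)))
  | .ex p φ, ρ, k, i =>
      Form.exMany k n (A.translate φ (Function.update ρ p fun j => k + j) (k + n) i)
  | .uni φ, _, _, _ => φ

theorem EventModel.translate_uFree {n : ℕ} (A : EventModel n) (hA : ∀ i, (A.pre i).UFree)
    (φ : Form) (hφ : φ.UFree) (ρ : ℕ → Fin n → ℕ) (k : ℕ) (i : Fin n) :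
    (A.translate φ ρ k i).UFree := by
  induction φ generalizing ρ k i with
  | atom p => exact ⟨hA i, trivial⟩
  | neg φ ih => exact ⟨hA i, ih hφ ρ k i⟩
  | and φ ψ ih₁ ih₂ => exact ⟨ih₁ hφ.1 ρ k i, ih₂ hφ.2 ρ k i⟩
  | box φ ih =>
    refine Form.UFree.conj (hA i) fun χ hχ => ?_
    obtain ⟨j, -, rfl⟩ := List.mem_map.1 hχ
    exact ⟨hA j, ih hφ ρ k j⟩
  | ex p φ ih => exact Form.UFree.exMany (ih hφ _ _ i) k n
  | uni φ => exact hφ.elim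

theorem EventModel.sat_translate {n : ℕ} (A : EventModel n) {N : ℕ}
    (hN : ∀ i p, (A.pre i).Occurs p → p < N) {W : Type} (M : Model W)
    (φ : Form) (hφ : φ.UFree) (hφN : ∀ p, φ.Occurs p → p < N)
    {ρ : ℕ → Fin n → ℕ} {k : ℕ} {V : ℕ → Set W} {Q : ℕ → Set (prodDomain M A)}
    (hk : N ≤ k) (hρ : ∀ p < N, ∀ j, ρ p j < k) (hV : ∀ p < N, V p = M.val p)
    (hQ : ∀ p < N, ∀ x, x ∈ Q p ↔ x.1.1 ∈ V (ρ p x.1.2)) (w : W) (i : Fin n) :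
    Sat ⟨M.rel, V⟩ w (A.translate φ ρ k i) ↔
      ∃ h : (w, i) ∈ prodDomain M A, Sat ⟨(prodModel M A).rel, Q⟩ ⟨(w, i), h⟩ φ := by
  have hpre : ∀ {V : ℕ → Set W}, (∀ p < N, V p = M.val p) → ∀ w i,
      Sat ⟨M.rel, V⟩ w (A.pre i) ↔ (w, i) ∈ prodDomain M A :=
    fun hV w i => sat_congr (A.pre i) (fun p hp => hV p (hN i p hp)) w
  induction φ generalizing ρ k V Q w i with
  | atom p =>
    simp only [translate, Sat, hpre hV]
    rw [← exists_prop]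
    exact exists_congr fun h => (hQ p (hφN p rfl) ⟨(w, i), h⟩).symm
  | neg φ ih =>
    simp only [translate, Sat, hpre hV, ih hφ hφN hk hρ hV hQ]
    exact ⟨fun ⟨h, h'⟩ => ⟨h, fun hs => h' ⟨h, hs⟩⟩, fun ⟨h, h'⟩ => ⟨h, fun ⟨_, hs⟩ => h' hs⟩⟩
  | and φ ψ ih₁ ih₂ =>
    simp only [translate, Sat, ih₁ hφ.1 (fun p hp => hφN p (Or.inl hp)) hk hρ hV hQ,
      ih₂ hφ.2 (fun p hp => hφN p (Or.inr hp)) hk hρ hV hQ]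
    exact ⟨fun ⟨⟨h, h₁⟩, ⟨_, h₂⟩⟩ => ⟨h, h₁, h₂⟩, fun ⟨h, h₁, h₂⟩ => ⟨⟨h, h₁⟩, ⟨h, h₂⟩⟩⟩
  | box φ ih =>
    simp only [translate, sat_conj, List.mem_map, List.mem_filter, List.mem_finRange, true_and,
      decide_eq_true_eq, forall_exists_index, and_imp, forall_apply_eq_imp_iff₂, Sat, Form.imp,
      hpre hV, ih hφ hφN hk hρ hV hQ]
    constructor
    · rintro ⟨h, hs⟩
      refine ⟨h, ?_⟩
      rintro ⟨⟨v, j⟩, hv⟩ ⟨hr, he⟩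
      by_contra hc
      exact hs j he v hr ⟨hv, fun ⟨_, hc'⟩ => hc hc'⟩
    · rintro ⟨h, hs⟩
      exact ⟨h, fun j he v hr ⟨hv, hc⟩ => hc ⟨hv, hs ⟨(v, j), hv⟩ ⟨hr, he⟩⟩⟩
  | ex p φ ih =>
    have hρ' : ∀ q < N, ∀ j, Function.update ρ p (fun j => k + j) q j < k + n := by
      intro q hq j
      by_cases e : q = p
      · subst e
        simp
      · rw [Function.update_of_ne e]
        exact (hρ q hq j).trans_le (Nat.le_add_right k n)
    have key : ∀ (V' : ℕ → Set W) (X : Set (prodDomain M A)),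
        (∀ q, q < k ∨ k + n ≤ q → V' q = V q) →
        (∀ x, x ∈ X ↔ x.1.1 ∈ V' (k + x.1.2)) →
        (Sat ⟨M.rel, V'⟩ w (A.translate φ (Function.update ρ p fun j => k + j) (k + n) i) ↔
          ∃ h : (w, i) ∈ prodDomain M A,
            Sat (Model.update ⟨(prodModel M A).rel, Q⟩ p X) ⟨(w, i), h⟩ φ) := by
      intro V' X hV' hX
      refine ih hφ (fun q hq => hφN q (Or.inr hq)) (hk.trans (Nat.le_add_right k n)) hρ'
        (fun q hq => (hV' q (Or.inl (hq.trans_le hk))).trans (hV q hq)) (fun q hq x => ?_) w i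
      by_cases e : q = p
      · subst e
        simpa using hX x
      · rw [Function.update_of_ne e, if_neg e, hQ q hq x, hV' _ (Or.inl (hρ q hq _))]
    simp only [translate, sat_exMany]
    constructor
    · rintro ⟨V', hV', h⟩
      obtain ⟨hd, hs⟩ := (key V' {x | x.1.1 ∈ V' (k + x.1.2)} hV' fun _ => Iff.rfl).1 h
      exact ⟨hd, _, hs⟩
    · rintro ⟨hd, X, hs⟩
      refine ⟨fun q => if q < k ∨ k + n ≤ q then V q else
        {v | ∃ x ∈ X, x.1.1 = v ∧ k + (x.1.2 : ℕ) = q}, fun q hq => if_pos hq,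
        (key _ X (fun q hq => if_pos hq) ?_).2 ⟨hd, hs⟩⟩
      rintro ⟨⟨v, j⟩, hv⟩
      rw [if_neg (by have := j.2; dsimp only; omega)]
      constructor
      · exact fun h => ⟨_, h, rfl, rfl⟩
      · rintro ⟨⟨⟨v', j'⟩, hv'⟩, hx, e₁, e₂⟩
        obtain rfl : v' = v := e₁
        obtain rfl : j' = j := Fin.ext (Nat.add_left_cancel e₂)
        exact hx
  | uni φ => exact hφ.elim

/-- `L∃` (propositionally quantified modal logic without the global
modality) is closed for product update: for every event model with `U`-free
preconditions, every event `α` and every `U`-free `ψ`, there is a `U`-free `χ` with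
`χ ≡ ⟨α⟩ψ` valid. -/
theorem stmt9 (n : ℕ) (hn : 0 < n) (A : EventModel n) (hA : ∀ i, (A.pre i).UFree)
    (α : Fin n) (ψ : Form) (hψ : ψ.UFree) :
    ∃ χ : Form, χ.UFree ∧
      ∀ (W : Type) (M : Model W) (ω : W),
        Sat M ω χ ↔
          ∃ h : (ω, α) ∈ prodDomain M A, Sat (prodModel M A) ⟨(ω, α), h⟩ ψ := by
  obtain ⟨a, ha⟩ := ψ.exists_occurs_bound
  choose b hb using fun i => (A.pre i).exists_occurs_bound
  set N := max a (Finset.univ.sup b)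
  have hψN : ∀ p, ψ.Occurs p → p < N := fun p hp => lt_max_of_lt_left (ha p hp)
  have hpN : ∀ i p, (A.pre i).Occurs p → p < N := fun i p hp =>
    lt_max_of_lt_right ((hb i p hp).trans_le (Finset.le_sup (Finset.mem_univ i)))
  exact ⟨A.translate ψ (fun p _ => p) N α, A.translate_uFree hA ψ hψ _ _ _, fun W M ω =>
    A.sat_translate hpN M ψ hψ hψN le_rfl (fun _ hp _ => hp) (fun _ _ => rfl)
      (fun _ _ _ => Iff.rfl) ω α⟩
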